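/- Let n ≥ 1, 0 ≤ k ≤ n, and r ≥ 0. The pullback map Φ^* restricts to a linear isomorphism from P_rΛ^k(T^n) onto P_{2r+k}Λ^k_e(S^n), the space of even forms in P_{2r+k}Λ^k(S^n). -/

import Mathlib

open scoped BigOperators
open MeasureTheory

noncomputable section

/-- Vectors in `ℝ^m`. -/
abbrev Vec (m : ℕ) := Fin m → ℝ

/-- Differential `k`-forms on `ℝ^m`, given pointwise as alternating `k`-tensors. -/
abbrev Form (m k : ℕ) := Vec m → (Vec m [⋀^Fin k]→ₗ[ℝ] ℝ)

/-- A multivariate polynomial has (total) degree at most `r : ℤ`. -/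
def degLE {m : ℕ} (r : ℤ) (p : MvPolynomial (Fin m) ℝ) : Prop :=
  ∀ d ∈ p.support, ((d.sum fun _ e => e : ℕ) : ℤ) ≤ r

/-- `P_rΛ^k(ℝ^m)`: differential `k`-forms with polynomial coefficients of degree at most `r`. -/
def PL (m k : ℕ) (r : ℤ) : Set (Form m k) :=
  {α | ∀ v : Fin k → Vec m, ∃ p : MvPolynomial (Fin m) ℝ,
      degLE r p ∧ ∀ x, α x v = MvPolynomial.eval x p}

/-- Interior product with the radial vector field `X = Σ xᵢ ∂/∂xᵢ`. -/
def iU {m k : ℕ} (β : Form m (k + 1)) : Form m k := fun x => (β x).curryLeft x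

/-- `P_r⁻Λ^k(ℝ^m) := i_X P_{r-1}Λ^{k+1}(ℝ^m)`. -/
def PLm (m k : ℕ) (r : ℤ) : Set (Form m k) := iU '' PL m (k + 1) (r - 1)

/-- The reflection negating the `i`-th coordinate, as a map. -/
def reflFun (m : ℕ) (i : Fin m) (u : Vec m) : Vec m := fun j => if j = i then -u j else u j

/-- The reflection negating the `i`-th coordinate, as a linear map. -/
def reflLin (m : ℕ) (i : Fin m) : Vec m →ₗ[ℝ] Vec m :=
  LinearMap.pi fun j => if j = i then -LinearMap.proj j else LinearMap.proj j

/-- Pullback of an ambient form along the reflection `R_i`. -/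
def reflPull (m k : ℕ) (i : Fin m) (α : Form m k) : Form m k :=
  fun x => (α (reflFun m i x)).compLinearMap (reflLin m i)

/-- A form on `ℝ^m` is even if it is invariant under all coordinate reflections. -/
def IsEven (m k : ℕ) (α : Form m k) : Prop := ∀ i, reflPull m k i α = α

/-- A form on `ℝ^m` is odd if every coordinate reflection negates it. -/
def IsOdd (m k : ℕ) (α : Form m k) : Prop := ∀ i, reflPull m k i α = -α

/-- The map `Φ(u) = (u₁², …, u_m²)`. -/
def Phi (m : ℕ) (u : Vec m) : Vec m := fun i => u i ^ 2

/-- The differential of `Φ` at `u`. -/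
def dPhi (m : ℕ) (u : Vec m) : Vec m →ₗ[ℝ] Vec m :=
  LinearMap.pi fun i => (2 * u i) • LinearMap.proj i

/-- Pullback of ambient forms along `Φ`. -/
def phiPull (m k : ℕ) (α : Form m k) : Form m k :=
  fun u => (α (Phi m u)).compLinearMap (dPhi m u)

/-- The standard simplex `T^{m-1} ⊂ ℝ^m`. -/
def simplexSet (m : ℕ) : Set (Vec m) := {x | (∀ i, 0 ≤ x i) ∧ ∑ i, x i = 1}

/-- The unit sphere `S^{m-1} ⊂ ℝ^m`. -/
def sphereSet (m : ℕ) : Set (Vec m) := {u | ∑ i, u i ^ 2 = 1}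

/-- The linear functional `v ↦ ⟨u, v⟩`. -/
def dotLin (m : ℕ) (u : Vec m) : Vec m →ₗ[ℝ] ℝ := ∑ i, u i • LinearMap.proj i

/-- Orthogonal projection onto the tangent space of the sphere at `u`. -/
def projSph (m : ℕ) (u : Vec m) : Vec m →ₗ[ℝ] Vec m :=
  LinearMap.id - (dotLin m u).smulRight u

/-- The linear functional `v ↦ Σ vᵢ`. -/
def sumLin (m : ℕ) : Vec m →ₗ[ℝ] ℝ := ∑ i, LinearMap.proj i

/-- Orthogonal projection onto the tangent hyperplane `{Σ vᵢ = 0}` of the simplex. -/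
def projSim (m : ℕ) : Vec m →ₗ[ℝ] Vec m :=
  LinearMap.id - ((m : ℝ)⁻¹ • sumLin m).smulRight (fun _ => 1)

/-- Differential `k`-forms on a subset `M ⊆ ℝ^m`, encoded at each point by the canonical
alternating tensor on `ℝ^m` that vanishes in the directions normal to `M` (i.e. the
pullback along the inclusion, extended by the tangent projection). -/
abbrev FormOn (m : ℕ) (M : Set (Vec m)) (k : ℕ) := M → (Vec m [⋀^Fin k]→ₗ[ℝ] ℝ)

/-- Restriction (pullback along the inclusion) of an ambient form to the simplex. -/
def resSim (m k : ℕ) (α : Form m k) : FormOn m (simplexSet m) k :=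
  fun x => (α x.1).compLinearMap (projSim m)

/-- Restriction (pullback along the inclusion) of an ambient form to the sphere. -/
def resSph (m k : ℕ) (α : Form m k) : FormOn m (sphereSet m) k :=
  fun u => (α u.1).compLinearMap (projSph m u.1)

/-- `P_rΛ^k(T^{m-1})`. -/
def PLsim (m k : ℕ) (r : ℤ) : Set (FormOn m (simplexSet m) k) := resSim m k '' PL m k r

/-- `P_rΛ^k(S^{m-1})`. -/
def PLsph (m k : ℕ) (r : ℤ) : Set (FormOn m (sphereSet m) k) := resSph m k '' PL m k r

/-- `P_r⁻Λ^k(T^{m-1})`. -/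
def PLmsim (m k : ℕ) (r : ℤ) : Set (FormOn m (simplexSet m) k) := resSim m k '' PLm m k r

/-- `P_r⁻Λ^k(S^{m-1})`. -/
def PLmsph (m k : ℕ) (r : ℤ) : Set (FormOn m (sphereSet m) k) := resSph m k '' PLm m k r

lemma phi_mem_simplex {m : ℕ} {u : Vec m} (hu : u ∈ sphereSet m) :
    Phi m u ∈ simplexSet m :=
  ⟨fun _ => sq_nonneg _, hu⟩

/-- Pullback `Φ^* : Λ^k(T^{m-1}) → Λ^k(S^{m-1})` along `Φ : S^{m-1} → T^{m-1}`. -/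
def phiPullTS (m k : ℕ) (a : FormOn m (simplexSet m) k) : FormOn m (sphereSet m) k :=
  fun u => (a ⟨Phi m u.1, phi_mem_simplex u.2⟩).compLinearMap
    ((dPhi m u.1).comp (projSph m u.1))

lemma refl_mem_sphere {m : ℕ} {i : Fin m} {u : Vec m} (hu : u ∈ sphereSet m) :
    reflFun m i u ∈ sphereSet m := by
  have : ∀ j, (reflFun m i u j) ^ 2 = u j ^ 2 := by
    intro j; simp only [reflFun]; split <;> ring
  simpa only [sphereSet, Set.mem_setOf_eq, this] using hu

/-- Pullback of a form on the sphere along the reflection `R_i`. -/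
def reflPullSph (m k : ℕ) (i : Fin m) (α : FormOn m (sphereSet m) k) :
    FormOn m (sphereSet m) k :=
  fun u => (α ⟨reflFun m i u.1, refl_mem_sphere u.2⟩).compLinearMap (reflLin m i)

/-- A form on the sphere is even if it is invariant under all coordinate reflections. -/
def IsEvenSph (m k : ℕ) (α : FormOn m (sphereSet m) k) : Prop :=
  ∀ i, reflPullSph m k i α = α

/-- A form on the sphere is odd if every coordinate reflection negates it. -/
def IsOddSph (m k : ℕ) (α : FormOn m (sphereSet m) k) : Prop :=
  ∀ i, reflPullSph m k i α = -α

/-- The bubble function `u_N = u₁ ⋯ u_m`. -/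
def bubble (m : ℕ) (u : Vec m) : ℝ := ∏ i, u i

/-- Multiplication of a form on the sphere by the bubble function. -/
def bubbleSmul (m k : ℕ) (α : FormOn m (sphereSet m) k) : FormOn m (sphereSet m) k :=
  fun u => bubble m u.1 • α u

/-- Multiplication of an ambient form by the bubble function. -/
def bubbleSmulAmb (m k : ℕ) (α : Form m k) : Form m k :=
  fun u => bubble m u • α u

/-- The standard volume form on `ℝ^m`. -/
def volForm (m : ℕ) : (Vec m) [⋀^Fin m]→ₗ[ℝ] ℝ := (Pi.basisFun ℝ (Fin m)).det

/-- Iterated interior product: insert the vectors `v 0, …, v (k-1)` into the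
first `k` slots of an alternating `(k+j)`-tensor. -/
def contrMany {m : ℕ} : (k : ℕ) → (Fin k → Vec m) → {j : ℕ} →
    ((Vec m) [⋀^Fin (k + j)]→ₗ[ℝ] ℝ) → ((Vec m) [⋀^Fin j]→ₗ[ℝ] ℝ)
  | 0, _, j, α => α.domDomCongr (finCongr (Nat.zero_add j))
  | (k + 1), v, j, α =>
      contrMany k (fun i => v i.succ)
        ((α.domDomCongr (finCongr (by omega : (k + 1) + j = (k + j) + 1))).curryLeft (v 0))

/-- The Hodge star on alternating tensors on `ℝ^m` (standard metric and orientation):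
`(⋆α)(w₁,…,w_{m-k}) = (1/k!) Σ_g α(e_{g 0},…,e_{g(k-1)}) vol(e_{g 0},…,e_{g(k-1)},w₁,…,w_{m-k})`. -/
def starAlt (m k : ℕ) (α : (Vec m) [⋀^Fin k]→ₗ[ℝ] ℝ) : (Vec m) [⋀^Fin (m - k)]→ₗ[ℝ] ℝ :=
  if h : k ≤ m then
    (k.factorial : ℝ)⁻¹ •
      ∑ g : Fin k → Fin m,
        α (fun i => Pi.single (g i) 1) •
          contrMany k (fun i => Pi.single (g i) 1)
            ((volForm m).domDomCongr (finCongr (by omega : m = k + (m - k))))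
  else 0

/-- The Hodge star `⋆_{ℝ^m}` applied pointwise to ambient forms. -/
def starR (m k : ℕ) (α : Form m k) : Form m (m - k) := fun x => starAlt m k (α x)

/-- The wedge product of alternating tensors. -/
def wedgeAlt {m k l : ℕ} (α : (Vec m) [⋀^Fin k]→ₗ[ℝ] ℝ) (β : (Vec m) [⋀^Fin l]→ₗ[ℝ] ℝ) :
    (Vec m) [⋀^Fin (k + l)]→ₗ[ℝ] ℝ :=
  ((TensorProduct.lid ℝ ℝ).toLinearMap.compAlternatingMap (α.domCoprod β)).domDomCongr
    finSumFinEquiv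

/-- The conormal `ν = Σ uᵢ duᵢ` at `u`, as an alternating 1-tensor. -/
def nuForm (m : ℕ) (u : Vec m) : (Vec m) [⋀^Fin 1]→ₗ[ℝ] ℝ :=
  AlternatingMap.ofSubsingleton ℝ (Vec m) ℝ (0 : Fin 1) (dotLin m u)

/-- The extended Hodge star `⋆_{S^{m-1}} α := ⋆_{ℝ^m}(ν ∧ α)` on ambient forms. -/
def starSphAmb (m k : ℕ) (α : Form m k) : Form m (m - (1 + k)) :=
  fun x => starAlt m (1 + k) (wedgeAlt (nuForm m x) (α x))

/-- The Hodge star of a form on the sphere (w.r.t. the round metric and the orientation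
induced by the outward normal), computed as the restriction of `⋆_{ℝ^m}(ν ∧ ·)`. -/
def starSph (m k : ℕ) (α : FormOn m (sphereSet m) k) :
    FormOn m (sphereSet m) (m - (1 + k)) :=
  fun u => (starAlt m (1 + k) (wedgeAlt (nuForm m u.1) (α u))).compLinearMap (projSph m u.1)

/-- Re-indexing a form along an equality of form degrees. -/
def castForm {m k l : ℕ} (h : k = l) (α : Form m k) : Form m l :=
  fun x => (α x).domDomCongr (finCongr h)

/-- Re-indexing a form on a subset along an equality of form degrees. -/
def castFormOn {m : ℕ} {M : Set (Vec m)} {k l : ℕ} (h : k = l) (α : FormOn m M k) :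
    FormOn m M l :=
  fun x => (α x).domDomCongr (finCongr h)

/-- Trace on the boundary of the simplex vanishes: at every boundary point (a point of some
face `xᵢ = 0`), the form vanishes on vectors tangent to that face. -/
def vanishBdry (m k : ℕ) (a : FormOn m (simplexSet m) k) : Prop :=
  ∀ (x : simplexSet m) (i : Fin m), x.1 i = 0 →
    ∀ v : Fin k → Vec m, (∀ j, (∑ l, v j l) = 0 ∧ v j i = 0) → a x v = 0

/-- `P̊_rΛ^k(T^{m-1})`: forms in `P_rΛ^k(T^{m-1})` with vanishing trace on the boundary. -/
def PLosim (m k : ℕ) (r : ℤ) : Set (FormOn m (simplexSet m) k) :=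
  {a ∈ PLsim m k r | vanishBdry m k a}

/-- `P̊_r⁻Λ^k(T^{m-1})`. -/
def PLmosim (m k : ℕ) (r : ℤ) : Set (FormOn m (simplexSet m) k) :=
  {a ∈ PLmsim m k r | vanishBdry m k a}

/-- A form on the sphere vanishes (as an alternating tensor on the tangent space)
at every point of `S^{m-1} ∩ Γ`, where `Γ = ∪ᵢ {uᵢ = 0}`. -/
def zeroOnGammaSph (m k : ℕ) (α : FormOn m (sphereSet m) k) : Prop :=
  ∀ u : sphereSet m, (∃ i, u.1 i = 0) →
    ∀ v : Fin k → Vec m, (∀ j, ∑ l, u.1 l * v j l = 0) → α u v = 0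

/-- An ambient form vanishes (as an alternating tensor) at every point of `Γ`. -/
def zeroOnGammaAmb (m k : ℕ) (α : Form m k) : Prop :=
  ∀ u : Vec m, (∃ i, u i = 0) → α u = 0

/-- The wedge product of forms on a subset. -/
def wedgeOn {m : ℕ} {M : Set (Vec m)} {k l : ℕ} (a : FormOn m M k) (b : FormOn m M l) :
    FormOn m M (k + l) :=
  fun x => wedgeAlt (a x) (b x)

/-- The base region of the parametrization of the simplex. -/
def baseSimplex (n : ℕ) : Set (Fin n → ℝ) := {y | (∀ j, 0 ≤ y j) ∧ ∑ j, y j ≤ 1}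

/-- Parametrization `y ↦ (1 - Σy, y)` of `T^n` over the base region. -/
def simplexParam (n : ℕ) (y : Fin n → ℝ) : Vec (n + 1) := Fin.cons (1 - ∑ j, y j) y

lemma simplexParam_mem {n : ℕ} {y : Fin n → ℝ} (h : y ∈ baseSimplex n) :
    simplexParam n y ∈ simplexSet (n + 1) := by
  constructor
  · intro i
    refine Fin.cases ?_ ?_ i
    · simpa [simplexParam] using sub_nonneg.mpr h.2
    · intro j; simpa [simplexParam] using h.1 j
  · simp [simplexParam, Fin.sum_cons]

/-- The coordinate tangent vectors `∂x/∂y_j = e_{j+1} - e_0` of the parametrization,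
a positively oriented frame for the orientation of `T^n` induced from the outward-normal
orientation of `S^n` via `Φ`. -/
def simplexTangent (n : ℕ) (j : Fin n) : Vec (n + 1) :=
  Fin.cons (-1) (Pi.single j 1)

open Classical in
/-- The integral of an `n`-form over the oriented simplex `T^n`. -/
def integralSimplex (n : ℕ) (ω : FormOn (n + 1) (simplexSet (n + 1)) n) : ℝ :=
  ∫ y : Fin n → ℝ,
    if h : y ∈ baseSimplex n then ω ⟨simplexParam n y, simplexParam_mem h⟩ (simplexTangent n)
    else 0

/-- Forms on a subset that genuinely are pullbacks to the simplex: they vanish in the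
normal directions (canonical representatives). -/
def TangentialSim (m k : ℕ) (a : FormOn m (simplexSet m) k) : Prop :=
  ∀ x, (a x).compLinearMap (projSim m) = a x

/-- Continuity of a form on a subset. -/
def ContFormOn (m : ℕ) (M : Set (Vec m)) (k : ℕ) (a : FormOn m M k) : Prop :=
  ∀ v : Fin k → Vec m, Continuous fun x : M => a x v

/-- The Riemannian volume form of the round sphere `S^{m-1}` (outward-normal orientation),
i.e. the restriction of `⋆_{ℝ^m} ν`. -/
def volSph (m : ℕ) : FormOn m (sphereSet m) (m - 1) :=
  fun u => (starAlt m 1 (nuForm m u.1)).compLinearMap (projSph m u.1)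

lemma degLE_natCast_iff {m : ℕ} (r : ℕ) (p : MvPolynomial (Fin m) ℝ) :
    degLE (r : ℤ) p ↔ p.totalDegree ≤ r := by
  simp only [degLE, Nat.cast_le, MvPolynomial.totalDegree, Finset.sup_le_iff]

/-- The sign change `X_i ↦ -X_i`, monomial by monomial. -/
def negVar {m : ℕ} (i : Fin m) (p : MvPolynomial (Fin m) ℝ) : MvPolynomial (Fin m) ℝ :=
  ∑ d ∈ p.support, MvPolynomial.monomial d ((-1) ^ d i * p.coeff d)

lemma coeff_negVar {m : ℕ} (i : Fin m) (p : MvPolynomial (Fin m) ℝ) (d : Fin m →₀ ℕ) :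
    (negVar i p).coeff d = (-1) ^ d i * p.coeff d := by
  classical
  simp only [negVar, MvPolynomial.coeff_sum, MvPolynomial.coeff_monomial]
  rw [Finset.sum_ite_eq']
  split_ifs with h
  · rfl
  · rw [MvPolynomial.notMem_support_iff.mp h, mul_zero]

lemma eval_negVar {m : ℕ} (i : Fin m) (p : MvPolynomial (Fin m) ℝ) (u : Vec m) :
    MvPolynomial.eval u (negVar i p) = MvPolynomial.eval (reflFun m i u) p := by
  rw [MvPolynomial.eval_eq' (reflFun m i u) p, negVar, map_sum]
  refine Finset.sum_congr rfl fun d _ => ?_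
  have h : ∀ j, reflFun m i u j ^ d j = (if j = i then (-1) ^ d j else 1) * u j ^ d j := by
    intro j
    simp only [reflFun]
    split_ifs
    · rw [← mul_pow, neg_one_mul]
    · rw [one_mul]
  simp only [h, Finset.prod_mul_distrib, Finset.prod_ite_eq', Finset.mem_univ, if_true]
  rw [MvPolynomial.eval_monomial, Finsupp.prod_fintype _ _ (by simp)]
  ring

lemma degLE_negVar {m : ℕ} {r : ℤ} (i : Fin m) {p : MvPolynomial (Fin m) ℝ} (h : degLE r p) :
    degLE r (negVar i p) := by
  intro d hd
  refine h d ?_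
  rw [MvPolynomial.mem_support_iff, coeff_negVar] at hd
  exact MvPolynomial.mem_support_iff.mpr (right_ne_zero_of_mul hd)

/-- A polynomial which has, in each variable, the parity of the exponent of a squarefree monomial
is the product of that monomial with a polynomial in the squares of the variables. -/
lemma exists_eval_eq_eval_Phi_mul {m r : ℕ} (c : Fin m → ℕ) (hc : ∀ i, c i ≤ 1)
    (p : MvPolynomial (Fin m) ℝ) (hp : p.totalDegree ≤ 2 * r + ∑ i, c i)
    (hpar : ∀ i u, MvPolynomial.eval (reflFun m i u) p = (-1) ^ c i * MvPolynomial.eval u p) :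
    ∃ q : MvPolynomial (Fin m) ℝ, q.totalDegree ≤ r ∧
      ∀ u, MvPolynomial.eval u p = MvPolynomial.eval (Phi m u) q * ∏ i, u i ^ c i := by
  have hmod : ∀ d ∈ p.support, ∀ i, d i = 2 * (d i / 2) + c i := by
    intro d hd i
    have hpoly : negVar i p = MvPolynomial.C ((-1) ^ c i) * p := by
      refine MvPolynomial.funext fun u => ?_
      rw [eval_negVar, hpar, map_mul, MvPolynomial.eval_C]
    have hcoeff := congrArg (MvPolynomial.coeff d) hpoly
    rw [coeff_negVar, MvPolynomial.coeff_C_mul] at hcoeff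
    have hsign : (-1 : ℝ) ^ d i = (-1) ^ c i :=
      mul_right_cancel₀ (MvPolynomial.mem_support_iff.mp hd) hcoeff
    have hc1 := hc i
    rcases Nat.even_or_odd (d i) with he | ho
    · have : c i = 0 := by
        by_contra h0
        have h1 : c i = 1 := by omega
        rw [h1, he.neg_one_pow] at hsign
        norm_num at hsign
      obtain ⟨e, he⟩ := he
      omega
    · have : c i = 1 := by
        by_contra h0
        have h1 : c i = 0 := by omega
        rw [h1, ho.neg_one_pow] at hsign
        norm_num at hsign
      obtain ⟨e, he⟩ := ho
      omega
  refine ⟨∑ d ∈ p.support,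
    MvPolynomial.monomial (Finsupp.equivFunOnFinite.symm fun i => d i / 2) (p.coeff d), ?_, ?_⟩
  · refine MvPolynomial.totalDegree_finsetSum_le fun d hd => ?_
    refine (MvPolynomial.totalDegree_monomial_le _ _).trans ?_
    have h1 := (MvPolynomial.le_totalDegree hd).trans hp
    rw [Finsupp.sum_fintype _ _ (by simp)] at h1 ⊢
    rw [Finset.sum_congr rfl fun i _ => hmod d hd i, Finset.sum_add_distrib,
      ← Finset.mul_sum] at h1
    simpa using h1
  · intro u
    rw [MvPolynomial.eval_eq', map_sum, Finset.sum_mul]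
    refine Finset.sum_congr rfl fun d hd => ?_
    rw [MvPolynomial.eval_monomial, Finsupp.prod_fintype _ _ (by simp), mul_assoc,
      ← Finset.prod_mul_distrib]
    congr 1
    refine Finset.prod_congr rfl fun i _ => ?_
    conv_lhs => rw [hmod d hd i]
    simp [Phi, pow_add, pow_mul]

/-- The alternating form `dx_{g 0} ∧ ⋯ ∧ dx_{g (k-1)}`. -/
def coordForm {m k : ℕ} (g : Fin k → Fin m) : Vec m [⋀^Fin k]→ₗ[ℝ] ℝ :=
  Matrix.detRowAlternating.compLinearMap (LinearMap.funLeft ℝ ℝ g)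

lemma coordForm_apply {m k : ℕ} (g : Fin k → Fin m) (v : Fin k → Vec m) :
    coordForm g v = Matrix.det (Matrix.of fun j i => v j (g i)) := rfl

lemma map_eq_sum_coord {m k : ℕ} (a : Vec m [⋀^Fin k]→ₗ[ℝ] ℝ) (v : Fin k → Vec m) :
    a v = ∑ g : Fin k → Fin m, (∏ j, v j (g j)) * a fun j => Pi.single (g j) 1 := by
  have hv : v = fun j => ∑ i, v j i • (Pi.single i 1 : Vec m) := by
    funext j
    exact pi_eq_sum_univ' (v j)
  conv_lhs => rw [hv]
  rw [← AlternatingMap.coe_multilinearMap, MultilinearMap.map_sum]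
  simp only [MultilinearMap.map_smul_univ, smul_eq_mul]

lemma factorial_mul_eq_sum_coordForm {m k : ℕ} (a : Vec m [⋀^Fin k]→ₗ[ℝ] ℝ)
    (v : Fin k → Vec m) :
    (k.factorial : ℝ) * a v =
      ∑ g : Fin k → Fin m, (a fun j => Pi.single (g j) 1) * coordForm g v := by
  simp only [coordForm_apply, Matrix.det_apply', Finset.mul_sum, Matrix.of_apply]
  rw [Finset.sum_comm]
  have h : ∀ σ : Equiv.Perm (Fin k), (∑ g : Fin k → Fin m, (a fun j => Pi.single (g j) 1) *
      (((Equiv.Perm.sign σ : ℤ) : ℝ) * ∏ i, v (σ i) (g i))) = a v := by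
    intro σ
    rw [map_eq_sum_coord a v]
    refine Fintype.sum_equiv (Equiv.arrowCongr σ (Equiv.refl _)) _ _ fun g => ?_
    have h1 : (∏ j, v j ((Equiv.arrowCongr σ (Equiv.refl (Fin m))) g j)) =
        ∏ i, v (σ i) (g i) := by
      rw [← Equiv.prod_comp σ]
      simp [Equiv.arrowCongr]
    have h2 : (a fun j => Pi.single (g j) 1) = ((Equiv.Perm.sign σ : ℤ) : ℝ) *
        a fun j => Pi.single ((Equiv.arrowCongr σ (Equiv.refl (Fin m))) g j) 1 := by
      have := a.map_perm
        (fun j => Pi.single ((Equiv.arrowCongr σ (Equiv.refl (Fin m))) g j) 1) σ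
      simp only [Function.comp_def, Equiv.arrowCongr_apply, Equiv.symm_apply_apply,
        Equiv.coe_refl, id] at this
      rw [this]
      simp [Units.smul_def, Function.comp_def]
    have h3 : (((Equiv.Perm.sign σ : ℤ) : ℝ)) * ((Equiv.Perm.sign σ : ℤ) : ℝ) = 1 := by
      rw [← Int.cast_mul, Int.units_coe_mul_self, Int.cast_one]
    rw [h1, h2]
    linear_combination (∏ i, v (σ i) (g i)) *
      (a fun j => Pi.single ((Equiv.arrowCongr σ (Equiv.refl (Fin m))) g j) 1) * h3
  rw [Finset.sum_congr rfl fun σ _ => h σ]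
  simp [Fintype.card_perm]

lemma alternatingMap_sum_apply {ι M N : Type*} [AddCommGroup M] [Module ℝ M] [AddCommGroup N]
    [Module ℝ N] {k : ℕ} (s : Finset ι) (f : ι → M [⋀^Fin k]→ₗ[ℝ] N) (v : Fin k → M) :
    (∑ i ∈ s, f i) v = ∑ i ∈ s, f i v :=
  map_sum (⟨⟨fun a => a v, rfl⟩, fun _ _ => rfl⟩ : (M [⋀^Fin k]→ₗ[ℝ] N) →+ N) f s

lemma coordForm_dPhi {m k : ℕ} (g : Fin k → Fin m) (u : Vec m) (v : Fin k → Vec m) :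
    (coordForm g fun j => dPhi m u (v j)) = 2 ^ k * (∏ j, u (g j)) * coordForm g v := by
  have h := Matrix.det_mul_row (fun i => 2 * u (g i)) (Matrix.of fun j i => v j (g i))
  rw [Finset.prod_mul_distrib] at h
  simp only [Finset.prod_const, Finset.card_univ, Fintype.card_fin] at h
  rw [coordForm_apply, coordForm_apply, ← h]
  rfl

lemma dPhi_apply {m : ℕ} (u v : Vec m) (i : Fin m) : dPhi m u v i = 2 * u i * v i := by
  simp [dPhi]

lemma dotLin_apply {m : ℕ} (u v : Vec m) : dotLin m u v = ∑ i, u i * v i := by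
  simp [dotLin]

lemma projSph_apply {m : ℕ} (u v : Vec m) : projSph m u v = v - dotLin m u v • u := by
  simp [projSph]

lemma projSim_apply_of_sum_eq_zero {m : ℕ} {w : Vec m} (h : ∑ i, w i = 0) :
    projSim m w = w := by
  simp [projSim, sumLin, h]

lemma sum_projSim {m : ℕ} [NeZero m] (w : Vec m) : ∑ i, projSim m w i = 0 := by
  have : (m : ℝ) ≠ 0 := Nat.cast_ne_zero.mpr (NeZero.ne m)
  simp [projSim, sumLin, this]

lemma projSim_dPhi_projSph {m : ℕ} {u : Vec m} (hu : u ∈ sphereSet m) (v : Vec m) :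
    projSim m (dPhi m u (projSph m u v)) = dPhi m u (projSph m u v) := by
  refine projSim_apply_of_sum_eq_zero ?_
  have hu' : ∑ i, u i ^ 2 = 1 := hu
  have h : ∀ i, dPhi m u (projSph m u v) i =
      2 * (u i * v i) - 2 * dotLin m u v * u i ^ 2 := by
    intro i
    rw [dPhi_apply, projSph_apply]
    simp only [Pi.sub_apply, Pi.smul_apply, smul_eq_mul]
    ring
  rw [Finset.sum_congr rfl fun i _ => h i, Finset.sum_sub_distrib, ← Finset.mul_sum,
    ← Finset.mul_sum, hu', dotLin_apply]
  ring

lemma phiPullTS_resSim {m k : ℕ} (α : Form m k) :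
    phiPullTS m k (resSim m k α) = resSph m k (phiPull m k α) := by
  funext u
  ext v
  simp only [phiPullTS, resSim, resSph, phiPull, AlternatingMap.compLinearMap_apply,
    LinearMap.comp_apply, projSim_dPhi_projSph u.2]

lemma reflLin_apply {m : ℕ} (i : Fin m) (v : Vec m) : reflLin m i v = reflFun m i v := by
  funext j
  simp only [reflLin, reflFun, LinearMap.pi_apply]
  split_ifs <;> simp

lemma reflFun_reflFun {m : ℕ} (i : Fin m) (v : Vec m) : reflFun m i (reflFun m i v) = v := by
  funext j
  simp only [reflFun]
  split_ifs <;> simp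

lemma reflFun_comm {m : ℕ} (i j : Fin m) (v : Vec m) :
    reflFun m i (reflFun m j v) = reflFun m j (reflFun m i v) := by
  funext l
  simp only [reflFun]
  split_ifs <;> simp

lemma projSph_reflFun {m : ℕ} (i : Fin m) (u v : Vec m) :
    projSph m (reflFun m i u) (reflFun m i v) = reflFun m i (projSph m u v) := by
  have h : dotLin m (reflFun m i u) (reflFun m i v) = dotLin m u v := by
    rw [dotLin_apply, dotLin_apply]
    refine Finset.sum_congr rfl fun j _ => ?_
    simp only [reflFun]
    split_ifs <;> ring
  rw [projSph_apply, projSph_apply, h]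
  funext j
  simp only [reflFun, Pi.sub_apply, Pi.smul_apply, smul_eq_mul]
  split_ifs <;> ring

lemma Phi_reflFun {m : ℕ} (i : Fin m) (u : Vec m) : Phi m (reflFun m i u) = Phi m u := by
  funext j
  simp only [Phi, reflFun]
  split_ifs <;> ring

lemma dPhi_reflFun {m : ℕ} (i : Fin m) (u v : Vec m) :
    dPhi m (reflFun m i u) (reflFun m i v) = dPhi m u v := by
  funext j
  simp only [dPhi_apply, reflFun]
  split_ifs <;> ring

lemma isEvenSph_phiPullTS {m k : ℕ} (a : FormOn m (simplexSet m) k) :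
    IsEvenSph m k (phiPullTS m k a) := by
  intro i
  funext u
  ext v
  simp only [reflPullSph, phiPullTS, AlternatingMap.compLinearMap_apply, LinearMap.comp_apply,
    reflLin_apply, projSph_reflFun, dPhi_reflFun, Phi_reflFun]

lemma resSph_reflPull {m k : ℕ} (i : Fin m) (α : Form m k) :
    resSph m k (reflPull m k i α) = reflPullSph m k i (resSph m k α) := by
  funext u
  ext v
  simp only [reflPullSph, reflPull, resSph, AlternatingMap.compLinearMap_apply, reflLin_apply,
    projSph_reflFun]

lemma reflPull_mem_PL {m k : ℕ} {r : ℤ} (i : Fin m) {α : Form m k} (h : α ∈ PL m k r) :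
    reflPull m k i α ∈ PL m k r := by
  intro v
  obtain ⟨p, hp, he⟩ := h fun j => reflLin m i (v j)
  exact ⟨negVar i p, degLE_negVar i hp, fun x => by rw [eval_negVar, ← he]; rfl⟩

/-- Averaging over the reflections makes a polynomial representative of an even form even. -/
lemma exists_isEven_resSph_eq {m k s : ℕ} {α : Form m k} (hα : α ∈ PL m k (s : ℤ))
    (he : IsEvenSph m k (resSph m k α)) :
    ∃ β ∈ PL m k (s : ℤ), IsEven m k β ∧ resSph m k β = resSph m k α := by
  suffices h : ∀ S : Finset (Fin m), ∃ β ∈ PL m k (s : ℤ),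
      (∀ i ∈ S, reflPull m k i β = β) ∧ resSph m k β = resSph m k α by
    obtain ⟨β, hβ, hS, hr⟩ := h Finset.univ
    exact ⟨β, hβ, fun i => hS i (Finset.mem_univ i), hr⟩
  intro S
  induction S using Finset.induction_on with
  | empty => exact ⟨α, hα, by simp, rfl⟩
  | insert i S _ ih =>
    obtain ⟨β, hβ, hS, hr⟩ := ih
    refine ⟨(2⁻¹ : ℝ) • (β + reflPull m k i β), ?_, ?_, ?_⟩
    · intro v
      obtain ⟨p, hp, hpe⟩ := hβ v
      obtain ⟨q, hq, hqe⟩ := reflPull_mem_PL i hβ v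
      rw [degLE_natCast_iff] at hp hq
      refine ⟨MvPolynomial.C 2⁻¹ * (p + q), ?_, fun x => ?_⟩
      · rw [degLE_natCast_iff]
        refine (MvPolynomial.totalDegree_mul _ _).trans ?_
        rw [MvPolynomial.totalDegree_C, zero_add]
        exact (MvPolynomial.totalDegree_add _ _).trans (max_le hp hq)
      · simp [hpe, hqe, mul_add]
    · intro j hj
      have hlin : reflPull m k j ((2⁻¹ : ℝ) • (β + reflPull m k i β)) =
          (2⁻¹ : ℝ) • (reflPull m k j β + reflPull m k j (reflPull m k i β)) := rfl
      rw [hlin]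
      rcases Finset.mem_insert.mp hj with rfl | hj
      · have hinv : reflPull m k j (reflPull m k j β) = β := by
          funext u
          ext v
          simp only [reflPull, AlternatingMap.compLinearMap_apply, reflLin_apply,
            reflFun_reflFun]
        rw [hinv, add_comm]
      · have hcomm : reflPull m k j (reflPull m k i β) =
            reflPull m k i (reflPull m k j β) := by
          funext u
          ext v
          simp only [reflPull, AlternatingMap.compLinearMap_apply, reflLin_apply,
            reflFun_comm i j]
        rw [hcomm, hS j hj]
    · have hlin : resSph m k ((2⁻¹ : ℝ) • (β + reflPull m k i β)) =
          (2⁻¹ : ℝ) • (resSph m k β + resSph m k (reflPull m k i β)) := rfl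
      rw [hlin, resSph_reflPull, hr, he i, ← two_smul ℝ, smul_smul]
      norm_num

lemma exists_coeff_of_isEven {m k r : ℕ} {α : Form m k} (hα : α ∈ PL m k ((2 * r + k : ℕ) : ℤ))
    (he : IsEven m k α) (g : Fin k → Fin m) :
    ∃ q : MvPolynomial (Fin m) ℝ, q.totalDegree ≤ r ∧
      ∀ u, (α u fun j => Pi.single (g j) 1) =
        MvPolynomial.eval (Phi m u) q * ∏ j, u (g j) := by
  by_cases hg : Function.Injective g
  · obtain ⟨p, hp, hpe⟩ := hα fun j => Pi.single (g j) 1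
    rw [degLE_natCast_iff] at hp
    set c : Fin m → ℕ := fun i => (Finset.univ.filter fun j => g j = i).card with hc
    have hprod : ∀ f : Fin m → ℝ, ∏ j, f (g j) = ∏ i, f i ^ c i := fun f =>
      (Finset.prod_fiberwise' Finset.univ g f).symm.trans <| by simp [hc]
    have hsum : ∑ i, c i = k := by
      have := Finset.card_eq_sum_card_fiberwise (f := g) (s := Finset.univ) (t := Finset.univ)
        (fun _ _ => Finset.mem_univ _)
      simpa [hc] using this.symm
    obtain ⟨q, hq, hqe⟩ := exists_eval_eq_eval_Phi_mul (r := r) c (fun i => by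
        rw [hc, Finset.card_le_one]
        intro a ha b hb
        simp only [Finset.mem_filter, Finset.mem_univ, true_and] at ha hb
        exact hg (ha.trans hb.symm)) p (by rwa [hsum]) (fun i u => by
        have h1 : ∀ j, reflLin m i (Pi.single (g j) 1) =
            (if g j = i then (-1 : ℝ) else 1) • (Pi.single (g j) 1 : Vec m) := by
          intro j
          rw [reflLin_apply]
          funext l
          simp only [reflFun, Pi.smul_apply, Pi.single_apply]
          split_ifs <;> simp_all
        have h2 : (α (reflFun m i u) fun j => reflLin m i (Pi.single (g j) 1)) =
            α u fun j => Pi.single (g j) 1 :=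
          congrArg (fun a => a fun j => Pi.single (g j) 1) (congrFun (he i) u)
        rw [funext h1, ← AlternatingMap.coe_multilinearMap, MultilinearMap.map_smul_univ,
          AlternatingMap.coe_multilinearMap, hpe, hpe,
          hprod fun l => if l = i then (-1 : ℝ) else 1] at h2
        simp only [ite_pow, one_pow, Finset.prod_ite_eq', Finset.mem_univ, if_true,
          smul_eq_mul] at h2
        rw [← h2, ← mul_assoc, ← mul_pow]
        norm_num)
    exact ⟨q, hq, fun u => by rw [hpe, hqe, hprod]⟩
  · refine ⟨0, by simp, fun u => ?_⟩
    obtain ⟨a, b, hab, hne⟩ := Function.not_injective_iff.mp hg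
    rw [(α u).map_eq_zero_of_eq _ (by simp only [hab]) hne]
    simp

/-- Even polynomial forms are pullbacks along `Φ` of polynomial forms. -/
lemma exists_phiPull_eq_of_isEven {m k r : ℕ} {α : Form m k}
    (hα : α ∈ PL m k ((2 * r + k : ℕ) : ℤ)) (he : IsEven m k α) :
    ∃ β ∈ PL m k (r : ℤ), phiPull m k β = α := by
  choose q hq hqe using exists_coeff_of_isEven hα he
  refine ⟨fun x => ∑ g : Fin k → Fin m,
    ((k.factorial : ℝ)⁻¹ * (2 ^ k)⁻¹ * MvPolynomial.eval x (q g)) • coordForm g, ?_, ?_⟩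
  · intro v
    refine ⟨∑ g : Fin k → Fin m,
      MvPolynomial.C ((k.factorial : ℝ)⁻¹ * (2 ^ k)⁻¹ * coordForm g v) * q g, ?_, fun x => ?_⟩
    · rw [degLE_natCast_iff]
      refine MvPolynomial.totalDegree_finsetSum_le fun g _ => ?_
      refine (MvPolynomial.totalDegree_mul _ _).trans ?_
      rw [MvPolynomial.totalDegree_C, zero_add]
      exact hq g
    · simp only [alternatingMap_sum_apply, AlternatingMap.smul_apply, smul_eq_mul, map_sum,
        map_mul, MvPolynomial.eval_C]
      exact Finset.sum_congr rfl fun g _ => by ring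
  · funext u
    ext v
    have hk : (k.factorial : ℝ) ≠ 0 := Nat.cast_ne_zero.mpr k.factorial_ne_zero
    refine mul_left_cancel₀ hk ?_
    rw [factorial_mul_eq_sum_coordForm (α u) v]
    simp only [phiPull, AlternatingMap.compLinearMap_apply, alternatingMap_sum_apply,
      AlternatingMap.smul_apply, smul_eq_mul, Finset.mul_sum, coordForm_dPhi, hqe]
    refine Finset.sum_congr rfl fun g _ => ?_
    field_simp

lemma phiPull_mem_PL {m k r : ℕ} {α : Form m k} (hα : α ∈ PL m k (r : ℤ)) :
    phiPull m k α ∈ PL m k ((2 * r + k : ℕ) : ℤ) := by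
  intro v
  choose p hp hpe using fun g : Fin k → Fin m => hα fun j => Pi.single (g j) 1
  refine ⟨∑ g : Fin k → Fin m, (∏ j, MvPolynomial.C (2 * v j (g j)) * MvPolynomial.X (g j)) *
    MvPolynomial.expand 2 (p g), ?_, fun u => ?_⟩
  · rw [degLE_natCast_iff]
    refine MvPolynomial.totalDegree_finsetSum_le fun g _ => ?_
    refine (MvPolynomial.totalDegree_mul _ _).trans ?_
    have h1 : (∏ j, MvPolynomial.C (2 * v j (g j)) *
        MvPolynomial.X (g j) : MvPolynomial (Fin m) ℝ).totalDegree ≤ k := by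
      refine (MvPolynomial.totalDegree_finsetProd _ _).trans ?_
      refine (Finset.sum_le_card_nsmul _ _ 1 fun j _ => ?_).trans (by simp)
      refine (MvPolynomial.totalDegree_mul _ _).trans ?_
      rw [MvPolynomial.totalDegree_C, MvPolynomial.totalDegree_X]
    have h2 : (MvPolynomial.expand 2 (p g) :
        MvPolynomial (Fin m) ℝ).totalDegree ≤ 2 * r := by
      have h3 := (degLE_natCast_iff _ _).mp (hp g)
      rw [MvPolynomial.totalDegree_expand]
      omega
    omega
  · rw [phiPull, AlternatingMap.compLinearMap_apply, map_eq_sum_coord, map_sum]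
    refine Finset.sum_congr rfl fun g _ => ?_
    rw [map_mul, map_prod, hpe]
    congr 1
    · refine Finset.prod_congr rfl fun j _ => ?_
      simp [dPhi]
      ring
    · rw [MvPolynomial.eval_expand]
      rfl

/-- A polynomial form on the simplex is determined by its pullback. -/
lemma resSim_eq_of_phiPullTS_eq {m k : ℕ} [NeZero m] {r : ℤ} {α β : Form m k}
    (hα : α ∈ PL m k r) (hβ : β ∈ PL m k r)
    (h : phiPullTS m k (resSim m k α) = phiPullTS m k (resSim m k β)) :
    resSim m k α = resSim m k β := by
  have hm : (0 : ℝ) < m := Nat.cast_pos.mpr (NeZero.pos m)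
  have hint : ∀ x ∈ simplexSet m, (∀ i, 0 < x i) → ∀ w : Fin k → Vec m,
      (α x fun j => projSim m (w j)) = β x fun j => projSim m (w j) := by
    intro x hx hpos w
    set u : Vec m := fun i => √(x i) with hu
    have hPhi : Phi m u = x := by
      funext i
      exact Real.sq_sqrt (hpos i).le
    have hu0 : ∀ i, u i ≠ 0 := fun i => (Real.sqrt_pos.mpr (hpos i)).ne'
    have hus : u ∈ sphereSet m := by
      change ∑ i, Phi m u i = 1
      rw [hPhi]
      exact hx.2
    have hv : ∀ j, dPhi m u (projSph m u fun i => projSim m (w j) i / (2 * u i)) =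
        projSim m (w j) := by
      intro j
      have hdot : dotLin m u (fun i => projSim m (w j) i / (2 * u i)) = 0 := by
        rw [dotLin_apply, Finset.sum_congr rfl fun i _ =>
          (by have := hu0 i; field_simp : u i * (projSim m (w j) i / (2 * u i)) =
            projSim m (w j) i / 2), ← Finset.sum_div, sum_projSim, zero_div]
      rw [projSph_apply, hdot, zero_smul, sub_zero]
      funext i
      rw [dPhi_apply]
      have := hu0 i
      field_simp
    have h1 := congrArg (fun a => a fun j i => projSim m (w j) i / (2 * u i))
      (congrFun h ⟨u, hus⟩)
    simpa only [phiPullTS, resSim, AlternatingMap.compLinearMap_apply, LinearMap.comp_apply, hv,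
      hPhi, projSim_apply_of_sum_eq_zero (sum_projSim _)] using h1
  funext x
  ext w
  obtain ⟨p, -, hp⟩ := hα fun j => projSim m (w j)
  obtain ⟨q, -, hq⟩ := hβ fun j => projSim m (w j)
  simp only [resSim, AlternatingMap.compLinearMap_apply]
  rw [hp, hq]
  set y : ℝ → Vec m := fun t i => (1 - t) * x.1 i + t * (m : ℝ)⁻¹ with hy
  have hcont : Continuous y := by fun_prop
  have heq : Set.EqOn (fun t => MvPolynomial.eval (y t) p) (fun t => MvPolynomial.eval (y t) q)
      (Set.Ioo 0 1) := by
    intro t ht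
    have hpos : ∀ i, 0 < y t i := fun i => add_pos_of_nonneg_of_pos
      (mul_nonneg (sub_nonneg.mpr ht.2.le) (x.2.1 i)) (mul_pos ht.1 (inv_pos.mpr hm))
    have hmem : y t ∈ simplexSet m := by
      refine ⟨fun i => (hpos i).le, ?_⟩
      simp only [hy, Finset.sum_add_distrib, ← Finset.mul_sum, x.2.2, Finset.sum_const,
        Finset.card_univ, Fintype.card_fin, nsmul_eq_mul]
      field_simp
      ring
    simpa only [hp, hq] using hint (y t) hmem hpos w
  have h0 := heq.closure ((MvPolynomial.continuous_eval p).comp hcont)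
    ((MvPolynomial.continuous_eval q).comp hcont)
    (show (0 : ℝ) ∈ closure (Set.Ioo 0 1) by rw [closure_Ioo zero_ne_one]; simp)
  simpa [hy] using h0

theorem stmt0 (n k r : ℕ) (hn : 1 ≤ n) (hk : k ≤ n) :
    Set.BijOn (phiPullTS (n + 1) k) (PLsim (n + 1) k (r : ℤ))
      {α ∈ PLsph (n + 1) k (2 * (r : ℤ) + k) | IsEvenSph (n + 1) k α} ∧
    (∀ a b, phiPullTS (n + 1) k (a + b) = phiPullTS (n + 1) k a + phiPullTS (n + 1) k b) ∧
    (∀ (c : ℝ) a, phiPullTS (n + 1) k (c • a) = c • phiPullTS (n + 1) k a) := by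
  have hdeg : 2 * (r : ℤ) + k = ((2 * r + k : ℕ) : ℤ) := by push_cast; rfl
  rw [hdeg]
  refine ⟨⟨?_, ?_, ?_⟩, fun _ _ => rfl, fun _ _ => rfl⟩
  · rintro _ ⟨α, hα, rfl⟩
    exact ⟨⟨phiPull (n + 1) k α, phiPull_mem_PL hα, (phiPullTS_resSim α).symm⟩,
      isEvenSph_phiPullTS _⟩
  · rintro _ ⟨α, hα, rfl⟩ _ ⟨β, hβ, rfl⟩ h
    exact resSim_eq_of_phiPullTS_eq hα hβ h
  · rintro _ ⟨⟨α, hα, rfl⟩, he⟩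
    obtain ⟨α', hα', he', hr⟩ := exists_isEven_resSph_eq hα he
    obtain ⟨β, hβ, hβe⟩ := exists_phiPull_eq_of_isEven hα' he'
    exact ⟨_, ⟨β, hβ, rfl⟩, by rw [phiPullTS_resSim, hβe, hr]⟩

end
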